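/- arXiv:1009.1090 — 2 statements merged into one kernel-verified Lean document; each statement's English description precedes it below -/
import Mathlib

section
/- Let ξ, k ∈ ℝ satisfy k² + 6ξ < 1 and set ν := √(1 − k² − 6ξ) > 0. Let φ : ℝ → ℝ be smooth with compact support contained in the open interval (0,∞). Define for t > 0 the function u(t) := − ∫₀ᵗ τ³ · ((t^ν τ^(−ν) − t^(−ν) τ^ν)/(2 t τ ν)) · φ(τ) dτ. Then u is twice differentiable on (0,∞) and for every t > 0 it satisfies u''(t) + (3/t) u'(t) + ((k² + 6ξ)/t²) u(t) = − φ(t); that is, the retarded Green's operator inverts the Fourier-mode wave operator −(∂_t² + (3/t)∂_t + (k²+6ξ)/t²) on compactly supported sources. -/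
/-- Multiplying a continuous function supported in `(0, ∞)` by a real power gives a continuous
function on the whole line. -/
lemma continuous_rpow_mul_of_tsupport_subset {φ : ℝ → ℝ} (hφ : Continuous φ)
    (hsupp : tsupport φ ⊆ Set.Ioi 0) (a : ℝ) : Continuous fun τ : ℝ => τ ^ a * φ τ := by
  refine continuous_of_tsupport fun x hx => ?_
  have hx0 : (0 : ℝ) < x := hsupp (tsupport_mul_subset_right hx)
  exact (Real.continuousAt_rpow_const x a (Or.inl hx0.ne')).mul hφ.continuousAt

lemma hasDerivAt_rpow_const_div {t : ℝ} (ht : 0 < t) (a : ℝ) :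
    HasDerivAt (fun x : ℝ => x ^ a) (a * t ^ a / t) t := by
  have h := Real.hasDerivAt_rpow_const (x := t) (p := a) (Or.inl ht.ne')
  rwa [Real.rpow_sub_one ht.ne', ← mul_div_assoc] at h

lemma integral_retarded_kernel_eq {φ : ℝ → ℝ} (hφ : Continuous φ)
    (hsupp : tsupport φ ⊆ Set.Ioi 0) {ν t : ℝ} (hν : ν ≠ 0) (ht : 0 < t) :
    ∫ τ in (0 : ℝ)..t,
        τ ^ 3 * ((t ^ ν * τ ^ (-ν) - t ^ (-ν) * τ ^ ν) / (2 * t * τ * ν)) * φ τ =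
      (t ^ ν * (∫ τ in (0 : ℝ)..t, τ ^ 2 * (τ ^ (-ν) * φ τ)) -
        t ^ (-ν) * ∫ τ in (0 : ℝ)..t, τ ^ 2 * (τ ^ ν * φ τ)) / (2 * ν * t) := by
  have hc (a : ℝ) : Continuous fun τ : ℝ => τ ^ 2 * (τ ^ a * φ τ) :=
    (continuous_pow 2).mul (continuous_rpow_mul_of_tsupport_subset hφ hsupp a)
  rw [← intervalIntegral.integral_const_mul, ← intervalIntegral.integral_const_mul,
    ← intervalIntegral.integral_sub (((hc _).const_mul _).intervalIntegrable _ _)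
      (((hc _).const_mul _).intervalIntegrable _ _), ← intervalIntegral.integral_div]
  refine intervalIntegral.integral_congr fun τ _ => ?_
  rcases eq_or_ne τ 0 with rfl | hτ
  · simp
  · field_simp

/-- On the spatially flat FRW toy-model, the retarded Green's operator in spatial Fourier
space inverts the Fourier-mode wave operator `-(∂_t² + (3/t)∂_t + (k²+6ξ)/t²)` on smooth
compactly supported sources in `(0,∞)`. -/
theorem frw_retarded_green_inverts
    (ξ k ν : ℝ) (hk : k ^ 2 + 6 * ξ < 1) (hν : ν = Real.sqrt (1 - k ^ 2 - 6 * ξ))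
    (φ : ℝ → ℝ) (hφ : ContDiff ℝ (⊤ : ℕ∞) φ) (hcs : HasCompactSupport φ)
    (hsupp : tsupport φ ⊆ Set.Ioi 0)
    (u : ℝ → ℝ)
    (hu : ∀ t : ℝ, u t =
      -∫ τ in (0:ℝ)..t,
        τ ^ 3 * ((t ^ ν * τ ^ (-ν) - t ^ (-ν) * τ ^ ν) / (2 * t * τ * ν)) * φ τ) :
    0 < ν ∧
    ∀ t ∈ Set.Ioi (0 : ℝ),
      DifferentiableAt ℝ u t ∧ DifferentiableAt ℝ (deriv u) t ∧
      deriv (deriv u) t + (3 / t) * deriv u t + ((k ^ 2 + 6 * ξ) / t ^ 2) * u t = -φ t := by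
  have hν0 : 0 < ν := hν ▸ Real.sqrt_pos.2 (by linarith)
  have hsq : k ^ 2 + 6 * ξ = 1 - ν ^ 2 := by
    rw [hν, Real.sq_sqrt (by linarith)]; ring
  refine ⟨hν0, ?_⟩
  set F : ℝ → ℝ → ℝ := fun a t => ∫ τ in (0 : ℝ)..t, τ ^ 2 * (τ ^ a * φ τ)
  have hF' (a t : ℝ) : HasDerivAt (F a) (t ^ 2 * (t ^ a * φ t)) t :=
    ((continuous_pow 2).mul (continuous_rpow_mul_of_tsupport_subset hφ.continuous hsupp
      a)).integral_hasStrictDerivAt 0 t |>.hasDerivAt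
  have hmul {t : ℝ} (ht : 0 < t) : t ^ ν * t ^ (-ν) = 1 := by
    rw [← Real.rpow_add ht, add_neg_cancel, Real.rpow_zero]
  have hu_eq {t : ℝ} (ht : 0 < t) :
      u t = -((t ^ ν * F (-ν) t - t ^ (-ν) * F ν t) / (2 * ν * t)) := by
    rw [hu, integral_retarded_kernel_eq hφ.continuous hsupp hν0.ne' ht]
  have hP {t : ℝ} (ht : 0 < t) : HasDerivAt (fun x => x ^ ν * F (-ν) x)
      (ν * t ^ ν / t * F (-ν) t + t ^ 2 * φ t) t := by
    refine ((hasDerivAt_rpow_const_div ht ν).mul (hF' (-ν) t)).congr_deriv ?_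
    linear_combination (t ^ 2 * φ t) * hmul ht
  have hQ {t : ℝ} (ht : 0 < t) : HasDerivAt (fun x => x ^ (-ν) * F ν x)
      (-ν * t ^ (-ν) / t * F ν t + t ^ 2 * φ t) t := by
    refine ((hasDerivAt_rpow_const_div ht (-ν)).mul (hF' ν t)).congr_deriv ?_
    linear_combination (t ^ 2 * φ t) * hmul ht
  have hu' {t : ℝ} (ht : 0 < t) : HasDerivAt u
      (((1 - ν) * (t ^ ν * F (-ν) t) - (1 + ν) * (t ^ (-ν) * F ν t)) / (2 * ν * t ^ 2)) t := by
    have h := (((hP ht).sub (hQ ht)).div ((hasDerivAt_id t).const_mul (2 * ν))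
      (mul_pos (mul_pos two_pos hν0) ht).ne').neg
    refine (h.congr_of_eventuallyEq ?_).congr_deriv ?_
    · filter_upwards [Ioi_mem_nhds ht] with x hx using hu_eq hx
    · simp only [id, Pi.sub_apply]
      field_simp
      ring
  have hu'' {t : ℝ} (ht : 0 < t) : HasDerivAt (deriv u)
      (-φ t - 3 / t * deriv u t - (1 - ν ^ 2) / t ^ 2 * u t) t := by
    have h := (((hP ht).const_mul (1 - ν)).sub ((hQ ht).const_mul (1 + ν))).div
      ((hasDerivAt_pow 2 t).const_mul (2 * ν)) (mul_pos (mul_pos two_pos hν0) (pow_pos ht 2)).ne'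
    refine (h.congr_of_eventuallyEq ?_).congr_deriv ?_
    · filter_upwards [Ioi_mem_nhds ht] with x hx using (hu' hx).deriv
    · rw [(hu' ht).deriv, hu_eq ht]
      simp only [Pi.sub_apply]
      field_simp
      ring
  intro t ht
  refine ⟨(hu' ht).differentiableAt, (hu'' ht).differentiableAt, ?_⟩
  rw [(hu'' ht).deriv, hsq]
  ring
end

section
/- Let λ > 0. The function ψ : ℝ³ → ℝ, ψ(k) = exp(−λ √(1 + ‖k‖²)), is a Schwartz function, but the function k ↦ (cosh(3λ k₁))^(1/2) · ψ(k) (with k₁ the first coordinate of k) is unbounded on ℝ³. Consequently there is no Schwartz function f ∈ 𝓢(ℝ³;ℂ) with ψ(k) = (cosh(3λ k₁))^(−1/2) · f(k) for all k; i.e., the map S given by multiplication by (cosh(3λ k₁))^(−1/2) is not surjective on 𝓢(ℝ³;ℂ). -/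
open scoped Nat ContDiff in
/-- If `f` has temperate growth and tends to `-∞` at least linearly, then `exp ∘ f` is a Schwartz
function. -/
theorem exists_schwartzMap_eq_exp {E : Type*} [NormedAddCommGroup E] [NormedSpace ℝ E]
    {f : E → ℝ} (hf : f.HasTemperateGrowth) {c : ℝ} (hc : 0 < c) (hfc : ∀ x, f x ≤ -(c * ‖x‖)) :
    ∃ g : SchwartzMap E ℝ, ∀ x, g x = Real.exp (f x) := by
  refine ⟨⟨Real.exp ∘ f, Real.contDiff_exp.comp hf.1, fun k n => ?_⟩, fun x => rfl⟩
  obtain ⟨l, C, hC, hbound⟩ := hf.norm_iteratedFDeriv_le_uniform n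
  set m := k + l * n with hm
  refine ⟨n ! * (C + 1) ^ n * (m ! / c ^ m * Real.exp c), fun x => ?_⟩
  have hcomp : ‖iteratedFDeriv ℝ n (Real.exp ∘ f) x‖ ≤
      n ! * Real.exp (f x) * ((C + 1) * (1 + ‖x‖) ^ l) ^ n := by
    refine norm_iteratedFDeriv_comp_le (N := ∞) Real.contDiff_exp hf.1 (mod_cast le_top) x
      (fun i _ => ?_) (fun i hi hin => ?_)
    · rw [norm_iteratedFDeriv_eq_norm_iteratedDeriv, iteratedDeriv_eq_iterate,
        Real.iter_deriv_exp, Real.norm_of_nonneg (Real.exp_pos _).le]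
    · have hpow : 1 ≤ (1 + ‖x‖) ^ l := one_le_pow₀ (by linarith [norm_nonneg x])
      calc ‖iteratedFDeriv ℝ i f x‖ ≤ C * (1 + ‖x‖) ^ l := hbound i hin x
        _ ≤ (C + 1) * (1 + ‖x‖) ^ l := by gcongr; linarith
        _ ≤ ((C + 1) * (1 + ‖x‖) ^ l) ^ i := le_self_pow₀ (by nlinarith) (by omega)
  have hdecay : (1 + ‖x‖) ^ m * Real.exp (f x) ≤ m ! / c ^ m * Real.exp c := by
    have hfact := Real.pow_div_factorial_le_exp (x := c * (1 + ‖x‖)) (by positivity) m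
    have hpow : (1 + ‖x‖) ^ m ≤ m ! / c ^ m * Real.exp (c * (1 + ‖x‖)) := by
      rw [mul_pow, div_le_iff₀ (by positivity)] at hfact
      rw [div_mul_eq_mul_div, le_div_iff₀ (by positivity)]
      linarith
    calc (1 + ‖x‖) ^ m * Real.exp (f x)
        ≤ m ! / c ^ m * Real.exp (c * (1 + ‖x‖)) * Real.exp (-(c * ‖x‖)) := by
          gcongr
          exact hfc x
      _ = m ! / c ^ m * Real.exp c := by
          rw [mul_assoc, ← Real.exp_add]
          ring_nf
  calc ‖x‖ ^ k * ‖iteratedFDeriv ℝ n (Real.exp ∘ f) x‖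
      ≤ (1 + ‖x‖) ^ k * (n ! * Real.exp (f x) * ((C + 1) * (1 + ‖x‖) ^ l) ^ n) := by
        gcongr
        linarith
    _ = n ! * (C + 1) ^ n * ((1 + ‖x‖) ^ m * Real.exp (f x)) := by
        rw [hm, mul_pow, ← pow_mul, pow_add]
        ring
    _ ≤ n ! * (C + 1) ^ n * (m ! / c ^ m * Real.exp c) := by gcongr

theorem exp_half_sub_le_cosh_rpow (x : ℝ) :
    Real.exp ((x - 1) / 2) ≤ Real.cosh x ^ ((1 : ℝ) / 2) := by
  have hcosh : Real.exp (x - 1) ≤ Real.cosh x := by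
    have h2 : 2 ≤ Real.exp 1 := by linarith [Real.add_one_le_exp 1]
    rw [Real.exp_sub, Real.cosh_eq, div_le_div_iff₀ (Real.exp_pos 1) two_pos]
    nlinarith [Real.exp_pos x, Real.exp_pos (-x)]
  calc Real.exp ((x - 1) / 2) = Real.exp (x - 1) ^ ((1 : ℝ) / 2) := by
        rw [← Real.exp_mul]
        ring_nf
    _ ≤ Real.cosh x ^ ((1 : ℝ) / 2) := by gcongr

theorem not_bounded_cosh_rpow_mul_exp (lam : ℝ) (hlam : 0 < lam) :
    ¬ ∃ C : ℝ, ∀ k : EuclideanSpace ℝ (Fin 3),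
        Real.cosh (3 * lam * k 0) ^ ((1 : ℝ) / 2) *
          Real.exp (-(lam * Real.sqrt (1 + ‖k‖ ^ 2))) ≤ C := by
  rintro ⟨C, hC⟩
  set t : ℝ := 2 / lam * (|C| + lam) with ht
  have htpos : 0 ≤ t := by positivity
  have hlt : lam * t = 2 * (|C| + lam) := by
    rw [ht]
    field_simp
  have hk := hC (PiLp.single 2 0 t)
  have hsqrt : Real.sqrt (1 + t ^ 2) ≤ 1 + t := Real.sqrt_le_iff.2 ⟨by linarith, by nlinarith⟩
  rw [PiLp.norm_single, Real.norm_of_nonneg htpos, PiLp.single_apply,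
    if_pos rfl] at hk
  have hlower : Real.exp ((3 * lam * t - 1) / 2) * Real.exp (-(lam * (1 + t))) ≤ C := by
    refine le_trans ?_ hk
    gcongr
    exact exp_half_sub_le_cosh_rpow _
  rw [← Real.exp_add] at hlower
  have := Real.add_one_le_exp ((3 * lam * t - 1) / 2 + -(lam * (1 + t)))
  linarith [le_abs_self C]


/-- The deformation map `S` (multiplication by `(cosh(3λk₁))^(-1/2)`) is not surjective on
Schwartz space: `ψ(k) = exp(-λ√(1+‖k‖²))` is Schwartz, but `(cosh(3λk₁))^(1/2) ψ(k)` is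
unbounded, so no Schwartz `f` satisfies `ψ = (cosh(3λk₁))^(-1/2) f`. -/
theorem deformation_map_not_surjective (lam : ℝ) (hlam : 0 < lam) :
    (∃ g : SchwartzMap (EuclideanSpace ℝ (Fin 3)) ℂ,
      ∀ k : EuclideanSpace ℝ (Fin 3),
        g k = (Real.exp (-(lam * Real.sqrt (1 + ‖k‖ ^ 2))) : ℂ)) ∧
    (¬ ∃ C : ℝ, ∀ k : EuclideanSpace ℝ (Fin 3),
        Real.cosh (3 * lam * k 0) ^ ((1 : ℝ) / 2) *
          Real.exp (-(lam * Real.sqrt (1 + ‖k‖ ^ 2))) ≤ C) ∧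
    ¬ ∃ f : SchwartzMap (EuclideanSpace ℝ (Fin 3)) ℂ,
      ∀ k : EuclideanSpace ℝ (Fin 3),
        (Real.exp (-(lam * Real.sqrt (1 + ‖k‖ ^ 2))) : ℂ) =
          ((Real.cosh (3 * lam * k 0) ^ (-(1 / 2) : ℝ) : ℝ) : ℂ) * f k := by
  have hunbdd := not_bounded_cosh_rpow_mul_exp lam hlam
  refine ⟨?_, hunbdd, ?_⟩
  · have htemp : (fun k : EuclideanSpace ℝ (Fin 3) =>
        -(lam * Real.sqrt (1 + ‖k‖ ^ 2))).HasTemperateGrowth := by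
      simp only [Real.sqrt_eq_rpow]
      fun_prop
    obtain ⟨g, hg⟩ := exists_schwartzMap_eq_exp htemp hlam fun k =>
      neg_le_neg (mul_le_mul_of_nonneg_left (Real.le_sqrt_of_sq_le (by linarith)) hlam.le)
    exact ⟨g.postcompCLM Complex.ofRealCLM, fun k => by simp [hg]⟩
  · rintro ⟨f, hf⟩
    refine hunbdd ⟨SchwartzMap.seminorm ℝ 0 0 f, fun k => ?_⟩
    refine le_trans (le_of_eq ?_) (SchwartzMap.norm_le_seminorm ℝ f k)
    have hcosh := Real.cosh_pos (3 * lam * k 0)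
    have hnorm := congrArg norm (hf k)
    rw [norm_mul, Complex.norm_of_nonneg (Real.exp_pos _).le,
      Complex.norm_of_nonneg (Real.rpow_nonneg hcosh.le _)] at hnorm
    rw [hnorm, ← mul_assoc, ← Real.rpow_add hcosh]
    simp
end
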